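/- Assume either n ≡ 7 (mod 12) and p divides (n+1)/4, or n ≡ 1 (mod 12) and p divides (n−1)/4 (so that q mod n ∈ D₀ and d₀(x), d₁(x) ∈ GF(q)[x]). Set Δ₁ = (n₁+1)/2 mod p, Δ₂ = (n₂−1)/2 mod p, and Δ = (n₁+1)(n₂−1)/2 mod p. Then Λ(β) ∈ {0, −1}, and g_λ(x) = (x^n−1)/gcd(x^n−1, Λ(x)) = (x^n−1)/(h(x)·d_j(x)), where j = 0 if Λ(β) = 0 and j = 1 if Λ(β) = −1, and where h(x) = 1 if Δ₁ ≠ 0, Δ₂ ≠ 0 and Δ ≠ 0; h(x) = x−1 if Δ₁ ≠ 0, Δ₂ ≠ 0 and Δ = 0; h(x) = x^{n₂}−1 if Δ₁ = 0 and Δ₂ ≠ 0; h(x) = x^{n₁}−1 if Δ₁ ≠ 0 and Δ₂ = 0; h(x) = (x^{n₁}−1)(x^{n₂}−1)/(x−1) if Δ₁ = Δ₂ = 0. Correspondingly, the linear complexity L_λ = n − deg gcd(x^n−1, Λ(x)) equals n − (n₁−1)(n₂−1)/2, n − ((n₁−1)(n₂−1)+2)/2, n − ((n₁+1)(n₂−1)+2)/2,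 n − ((n₁−1)(n₂+1)+2)/2 and n − ((n₁+1)(n₂+1)−2)/2 in the respective cases. -/

import Mathlib

open Polynomial

/-- The sum of `γ ^ a` over the `a` in `ℤ/ℓℤ` of quadratic character `ε`. -/
def quadPeriod {K : Type*} [CommRing K] (ℓ : ℕ) [Fact ℓ.Prime] (ε : ℤ) (γ : K) : K :=
  ∑ a : ZMod ℓ with quadraticChar (ZMod ℓ) a = ε, γ ^ a.val

section QuadPeriod

variable {K : Type*} [CommRing K] {ℓ : ℕ} [Fact ℓ.Prime]

lemma sum_eq_zero_add_sum_quadraticChar (f : ZMod ℓ → K) :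
    ∑ a, f a = f 0 + (∑ a : ZMod ℓ with quadraticChar (ZMod ℓ) a = 1, f a +
      ∑ a : ZMod ℓ with quadraticChar (ZMod ℓ) a = -1, f a) := by
  have h0 : f 0 = ∑ a : ZMod ℓ, if a = 0 then f a else 0 := by simp
  rw [Finset.sum_filter, Finset.sum_filter, h0, ← Finset.sum_add_distrib,
    ← Finset.sum_add_distrib]
  refine Finset.sum_congr rfl fun a _ => ?_
  by_cases ha : a = 0
  · simp [ha]
  · rcases quadraticChar_dichotomy ha with h | h <;> simp only [h, if_neg ha] <;> norm_num

lemma sum_quadraticChar_mul (f : ZMod ℓ → K) :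
    ∑ a, (quadraticChar (ZMod ℓ) a : K) * f a =
      ∑ a : ZMod ℓ with quadraticChar (ZMod ℓ) a = 1, f a -
      ∑ a : ZMod ℓ with quadraticChar (ZMod ℓ) a = -1, f a := by
  rw [Finset.sum_filter, Finset.sum_filter, ← Finset.sum_sub_distrib]
  refine Finset.sum_congr rfl fun a _ => ?_
  by_cases ha : a = 0
  · simp [ha]
  · rcases quadraticChar_dichotomy ha with h | h <;> simp [h]

lemma sum_zmod_pow_val (γ : K) : ∑ a : ZMod ℓ, γ ^ a.val = ∑ i ∈ Finset.range ℓ, γ ^ i := by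
  refine Finset.sum_bij (fun a _ => a.val) (fun a _ => by simpa using a.val_lt)
    (fun a _ b _ h => ZMod.val_injective ℓ h)
    (fun b hb => ⟨(b : ZMod ℓ), Finset.mem_univ _, ZMod.val_cast_of_lt (by simpa using hb)⟩)
    fun a _ => rfl

lemma map_quadPeriod {K' : Type*} [CommRing K'] (f : K →+* K') (ε : ℤ) (γ : K) :
    f (quadPeriod ℓ ε γ) = quadPeriod ℓ ε (f γ) := by
  simp only [quadPeriod, map_sum, map_pow]

lemma quadPeriod_add_of_isPrimitiveRoot [IsDomain K] {γ : K} (hγ : IsPrimitiveRoot γ ℓ) :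
    quadPeriod ℓ 1 γ + quadPeriod ℓ (-1) γ = -1 := by
  have h := sum_eq_zero_add_sum_quadraticChar (ℓ := ℓ) (fun a => γ ^ a.val)
  rw [sum_zmod_pow_val, hγ.geom_sum_eq_zero (Fact.out : ℓ.Prime).one_lt] at h
  simp only [ZMod.val_zero, pow_zero] at h
  unfold quadPeriod
  linear_combination -h

lemma card_quadraticChar_eq (hℓ : Odd ℓ) {ε : ℤ} (hε : ε = 1 ∨ ε = -1) :
    Finset.card {a : ZMod ℓ | quadraticChar (ZMod ℓ) a = ε} = (ℓ - 1) / 2 := by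
  have h₁ := sum_eq_zero_add_sum_quadraticChar (ℓ := ℓ) (fun _ => (1 : ℤ))
  have h₂ := sum_quadraticChar_mul (ℓ := ℓ) (fun _ => (1 : ℤ))
  have h₃ : ringChar (ZMod ℓ) ≠ 2 := by
    rw [ZMod.ringChar_zmod_n]
    rintro rfl
    exact absurd hℓ (by decide)
  simp only [mul_one, Int.cast_id, quadraticChar_sum_zero h₃] at h₂
  simp only [Finset.sum_const, Finset.card_univ, ZMod.card, nsmul_eq_mul, mul_one] at h₁ h₂
  rcases hε with rfl | rfl <;> omega

lemma quadPeriod_one (hℓ : Odd ℓ) {ε : ℤ} (hε : ε = 1 ∨ ε = -1) :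
    quadPeriod ℓ ε (1 : K) = ((ℓ - 1) / 2 : ℕ) := by
  simp only [quadPeriod, one_pow, Finset.sum_const, card_quadraticChar_eq hℓ hε, nsmul_one]

lemma pow_val_natCast {γ : K} (hγ : γ ^ ℓ = 1) (k : ℕ) : γ ^ (k : ZMod ℓ).val = γ ^ k := by
  rw [ZMod.val_natCast, ← pow_mod_orderOf, Nat.mod_mod_of_dvd _ (orderOf_dvd_of_pow_eq_one hγ),
    pow_mod_orderOf]

lemma quadPeriod_pow {γ : K} (hγ : γ ^ ℓ = 1) {k : ℕ} {δ : ℤ}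
    (hk : quadraticChar (ZMod ℓ) k = δ) (hδ : δ = 1 ∨ δ = -1) (ε : ℤ) :
    quadPeriod ℓ ε (γ ^ k) = quadPeriod ℓ (δ * ε) γ := by
  have hk0 : (k : ZMod ℓ) ≠ 0 := by
    intro h
    rw [h, MulChar.map_zero] at hk
    omega
  have hδ2 : δ * δ = 1 := by rcases hδ with rfl | rfl <;> norm_num
  refine Finset.sum_bij (fun a _ => k * a) ?_ ?_ ?_ ?_
  · intro a ha
    simp only [Finset.mem_filter, Finset.mem_univ, true_and, map_mul] at ha ⊢
    rw [hk, ha]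
  · intro a _ b _ h
    exact mul_left_cancel₀ hk0 h
  · intro b hb
    simp only [Finset.mem_filter, Finset.mem_univ, true_and] at hb
    refine ⟨(k : ZMod ℓ)⁻¹ * b, ?_, by field_simp⟩
    simp only [Finset.mem_filter, Finset.mem_univ, true_and]
    have : quadraticChar (ZMod ℓ) (k * ((k : ZMod ℓ)⁻¹ * b)) = δ * ε := by
      rw [mul_inv_cancel_left₀ hk0, hb]
    rw [map_mul, hk] at this
    linear_combination δ * this - (quadraticChar (ZMod ℓ) ((k : ZMod ℓ)⁻¹ * b) - ε) * hδ2
  · intro a _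
    have : (k : ZMod ℓ) * a = ((k * a.val : ℕ) : ZMod ℓ) := by simp
    rw [this, pow_val_natCast hγ, pow_mul]

lemma four_mul_quadPeriod_mul_quadPeriod_complex (hℓ : Odd ℓ) {ζ : ℂ}
    (hζ : IsPrimitiveRoot ζ ℓ) :
    4 * (quadPeriod ℓ 1 ζ * quadPeriod ℓ (-1) ζ) = 1 - quadraticChar (ZMod ℓ) (-1) * ℓ := by
  have h₃ : ringChar (ZMod ℓ) ≠ 2 := by
    rw [ZMod.ringChar_zmod_n]
    rintro rfl
    exact absurd hℓ (by decide)
  have hsq := gaussSum_sq (χ := (quadraticChar (ZMod ℓ)).ringHomComp (Int.castRingHom ℂ))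
    (by
      intro h
      obtain ⟨a, ha⟩ := quadraticChar_exists_neg_one h₃
      have h0 : a ≠ 0 := by
        rintro rfl
        simp at ha
      have := congrArg (fun χ : MulChar (ZMod ℓ) ℂ => χ a) h
      simp only [MulChar.ringHomComp_apply, ha, MulChar.one_apply h0.isUnit] at this
      norm_num at this)
    ((quadraticChar_isQuadratic (ZMod ℓ)).comp _)
    (AddChar.zmodChar_primitive_of_primitive_root ℓ hζ)
  have hg : gaussSum ((quadraticChar (ZMod ℓ)).ringHomComp (Int.castRingHom ℂ))
      (AddChar.zmodChar ℓ hζ.pow_eq_one) = quadPeriod ℓ 1 ζ - quadPeriod ℓ (-1) ζ := by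
    simp only [gaussSum, MulChar.ringHomComp_apply, AddChar.zmodChar_apply, eq_intCast]
    exact sum_quadraticChar_mul _
  have hs := quadPeriod_add_of_isPrimitiveRoot hζ
  rw [hg] at hsq
  simp only [MulChar.ringHomComp_apply, eq_intCast, ZMod.card] at hsq
  linear_combination (quadPeriod ℓ 1 ζ + quadPeriod ℓ (-1) ζ - 1) * hs - hsq

lemma aeval_eq_zero_of_isPrimitiveRoot [IsDomain K] {n : ℕ} (hn : 0 < n) {ζ : ℂ}
    (hζ : IsPrimitiveRoot ζ n) {γ : K} (hγ : IsPrimitiveRoot γ n) {f : ℤ[X]}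
    (hf : aeval ζ f = 0) : aeval γ f = 0 := by
  have h : cyclotomic n ℤ ∣ f := by
    rw [cyclotomic_eq_minpoly hζ hn]
    exact minpoly.isIntegrallyClosed_dvd (hζ.isIntegral hn) hf
  obtain ⟨r, rfl⟩ := h
  have := hγ.isRoot_cyclotomic hn
  rw [IsRoot.def, ← map_cyclotomic_int, eval_map, ← algebraMap_int_eq, ← aeval_def] at this
  rw [map_mul, this, zero_mul]

lemma quadPeriod_mul_quadPeriod [IsDomain K] (hℓ : Odd ℓ) {γ : K} (hγ : IsPrimitiveRoot γ ℓ)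
    {c : ℤ} (hc : 4 * c = 1 - quadraticChar (ZMod ℓ) (-1) * ℓ) :
    quadPeriod ℓ 1 γ * quadPeriod ℓ (-1) γ = c := by
  have hpos := (Fact.out : ℓ.Prime).pos
  have hζ := Complex.isPrimitiveRoot_exp ℓ hpos.ne'
  have h := aeval_eq_zero_of_isPrimitiveRoot hpos hζ hγ
    (f := quadPeriod ℓ 1 X * quadPeriod ℓ (-1) X - (c : ℤ[X])) (by
      have h₄ := four_mul_quadPeriod_mul_quadPeriod_complex hℓ hζ
      have hc' : (4 : ℂ) * c = 1 - quadraticChar (ZMod ℓ) (-1) * ℓ := by exact_mod_cast hc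
      rw [← hc'] at h₄
      rw [← AlgHom.coe_toRingHom, map_sub, map_mul, map_quadPeriod, map_quadPeriod, map_intCast,
        AlgHom.coe_toRingHom, aeval_X, mul_left_cancel₀ (by norm_num : (4 : ℂ) ≠ 0) h₄, sub_self])
  rw [← AlgHom.coe_toRingHom, map_sub, map_mul, map_quadPeriod, map_quadPeriod, map_intCast,
    AlgHom.coe_toRingHom, aeval_X] at h
  exact sub_eq_zero.mp h

end QuadPeriod

/-- The residues modulo `n₁ * n₂` whose Jacobi symbol is `ε`. -/
def jacobiClass (n₁ n₂ : ℕ) [Fact n₁.Prime] [Fact n₂.Prime] (ε : ℤ) : Finset (ZMod (n₁ * n₂)) :=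
  {i | quadraticChar (ZMod n₁) i.val * quadraticChar (ZMod n₂) i.val = ε}

section CRT

variable {K : Type*} [CommRing K] {n₁ n₂ : ℕ} [Fact n₁.Prime] [Fact n₂.Prime]

lemma sum_zmod_mul (h : n₁.Coprime n₂) (f : ZMod n₁ → ZMod n₂ → K) :
    ∑ i : ZMod (n₁ * n₂), f i.val i.val = ∑ a, ∑ b, f a b := by
  rw [← Fintype.sum_prod_type', ← (ZMod.chineseRemainder h).toEquiv.sum_comp]
  refine Finset.sum_congr rfl fun i _ => ?_
  have : ZMod.chineseRemainder h i = ((i.val : ZMod n₁), (i.val : ZMod n₂)) := by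
    conv_lhs => rw [← ZMod.natCast_zmod_val i]
    rw [map_natCast]
    rfl
  simp [this]

lemma sum_jacobiClass (h : n₁.Coprime n₂) {x₁ x₂ : K} (h₁ : x₁ ^ n₁ = 1) (h₂ : x₂ ^ n₂ = 1)
    {ε : ℤ} (hε : ε = 1 ∨ ε = -1) :
    ∑ i ∈ jacobiClass n₁ n₂ ε, (x₁ * x₂) ^ i.val =
      quadPeriod n₁ 1 x₁ * quadPeriod n₂ ε x₂ + quadPeriod n₁ (-1) x₁ * quadPeriod n₂ (-ε) x₂ := by
  have key := sum_zmod_mul h fun a b => if quadraticChar (ZMod n₁) a * quadraticChar (ZMod n₂) b = ε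
    then x₁ ^ a.val * x₂ ^ b.val else 0
  simp only [pow_val_natCast h₁, pow_val_natCast h₂, ← mul_pow] at key
  rw [jacobiClass, Finset.sum_filter, key, sum_eq_zero_add_sum_quadraticChar]
  have hε0 : ¬ (0 = ε) := by omega
  simp only [MulChar.map_zero, zero_mul, if_neg hε0, Finset.sum_const_zero, zero_add]
  congr 1
  · rw [quadPeriod, Finset.sum_mul]
    refine Finset.sum_congr rfl fun a ha => ?_
    rw [Finset.mem_filter] at ha
    rw [quadPeriod, Finset.mul_sum, Finset.sum_filter]
    simp only [ha.2, one_mul]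
  · rw [quadPeriod, Finset.sum_mul]
    refine Finset.sum_congr rfl fun a ha => ?_
    rw [Finset.mem_filter] at ha
    rw [quadPeriod, Finset.mul_sum, Finset.sum_filter]
    simp only [ha.2, neg_mul, one_mul, neg_eq_iff_eq_neg]

lemma card_jacobiClass (h : n₁.Coprime n₂) (ho₁ : Odd n₁) (ho₂ : Odd n₂) {ε : ℤ}
    (hε : ε = 1 ∨ ε = -1) :
    (jacobiClass n₁ n₂ ε).card = 2 * ((n₁ - 1) / 2 * ((n₂ - 1) / 2)) := by
  have := sum_jacobiClass (K := ℤ) h (one_pow n₁) (one_pow n₂) hε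
  rw [quadPeriod_one ho₁ (Or.inl rfl), quadPeriod_one ho₁ (Or.inr rfl), quadPeriod_one ho₂ hε,
    quadPeriod_one ho₂ (by omega)] at this
  simp only [mul_one, one_pow, Finset.sum_const, nsmul_eq_mul] at this
  rw [← two_mul] at this
  exact_mod_cast this

/-- The defining set of the sequence: the nonzero multiples of `n₁` and the residues of Jacobi
symbol `-1`. -/
def sequenceSupport (n₁ n₂ : ℕ) [Fact n₁.Prime] [Fact n₂.Prime] : Finset (ZMod (n₁ * n₂)) :=
  ({i | (i.val : ZMod n₁) = 0 ∧ (i.val : ZMod n₂) ≠ 0} : Finset _) ∪ jacobiClass n₁ n₂ (-1)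

lemma sum_sequenceSupport (h : n₁.Coprime n₂) {x₁ x₂ : K} (h₁ : x₁ ^ n₁ = 1) (h₂ : x₂ ^ n₂ = 1) :
    ∑ i ∈ sequenceSupport n₁ n₂, (x₁ * x₂) ^ i.val =
      quadPeriod n₂ 1 x₂ + quadPeriod n₂ (-1) x₂ +
      (quadPeriod n₁ 1 x₁ * quadPeriod n₂ (-1) x₂ +
        quadPeriod n₁ (-1) x₁ * quadPeriod n₂ 1 x₂) := by
  rw [sequenceSupport, Finset.sum_union, sum_jacobiClass h h₁ h₂ (Or.inr rfl), neg_neg]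
  · congr 1
    have key := sum_zmod_mul h fun a b => if a = 0 ∧ b ≠ 0 then x₁ ^ a.val * x₂ ^ b.val else 0
    simp only [pow_val_natCast h₁, pow_val_natCast h₂, ← mul_pow] at key
    rw [Finset.sum_filter, key, Finset.sum_eq_single 0 (by simp +contextual) (by simp),
      sum_eq_zero_add_sum_quadraticChar]
    simp only [ne_eq, not_true_eq_false, and_false, if_false, zero_add, true_and, ZMod.val_zero,
      pow_zero, one_mul, quadPeriod]
    congr 1 <;>
    · refine Finset.sum_congr rfl fun b hb => if_pos ?_
      rintro rfl
      simp at hb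
  · rw [Finset.disjoint_left]
    intro i hi hj
    simp only [jacobiClass, Finset.mem_filter, Finset.mem_univ, true_and] at hi hj
    rw [hi.1, MulChar.map_zero] at hj
    simp at hj

lemma exists_four_mul_eq {ℓ : ℕ} [Fact ℓ.Prime] (hℓ : Odd ℓ) :
    ∃ c : ℤ, 4 * c = 1 - quadraticChar (ZMod ℓ) (-1) * ℓ := by
  have h₃ : ringChar (ZMod ℓ) ≠ 2 := by
    rw [ZMod.ringChar_zmod_n]
    rintro rfl
    exact absurd hℓ (by decide)
  rw [quadraticChar_neg_one h₃, ZMod.card]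
  rcases Nat.odd_mod_four_iff.mp (Nat.odd_iff.mp hℓ) with h | h
  · rw [ZMod.χ₄_nat_one_mod_four h]
    exact ⟨(1 - 1 * ℓ) / 4, by omega⟩
  · rw [ZMod.χ₄_nat_three_mod_four h]
    exact ⟨(1 - -1 * ℓ) / 4, by omega⟩

lemma quadraticChar_neg_one_mul (ho₁ : Odd n₁) (ho₂ : Odd n₂) :
    quadraticChar (ZMod n₁) (-1) * quadraticChar (ZMod n₂) (-1) = ZMod.χ₄ (n₁ * n₂ : ℕ) := by
  have h₃ : ∀ ℓ [Fact ℓ.Prime], Odd ℓ → ringChar (ZMod ℓ) ≠ 2 := by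
    intro ℓ _ hℓ
    rw [ZMod.ringChar_zmod_n]
    rintro rfl
    exact absurd hℓ (by decide)
  rw [quadraticChar_neg_one (h₃ _ ho₁), quadraticChar_neg_one (h₃ _ ho₂), ZMod.card, ZMod.card,
    Nat.cast_mul, map_mul]

lemma jacobiPeriod_add_mul [IsDomain K] (p : ℕ) [CharP K p] (ho₁ : Odd n₁) (ho₂ : Odd n₂)
    (hcase : (n₁ * n₂ % 12 = 7 ∧ p ∣ (n₁ * n₂ + 1) / 4) ∨
      (n₁ * n₂ % 12 = 1 ∧ p ∣ (n₁ * n₂ - 1) / 4))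
    {x₁ x₂ : K} (h₁ : IsPrimitiveRoot x₁ n₁) (h₂ : IsPrimitiveRoot x₂ n₂) :
    (quadPeriod n₁ 1 x₁ * quadPeriod n₂ 1 x₂ + quadPeriod n₁ (-1) x₁ * quadPeriod n₂ (-1) x₂) +
      (quadPeriod n₁ 1 x₁ * quadPeriod n₂ (-1) x₂ +
        quadPeriod n₁ (-1) x₁ * quadPeriod n₂ 1 x₂) = 1 ∧
    (quadPeriod n₁ 1 x₁ * quadPeriod n₂ 1 x₂ + quadPeriod n₁ (-1) x₁ * quadPeriod n₂ (-1) x₂) *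
      (quadPeriod n₁ 1 x₁ * quadPeriod n₂ (-1) x₂ +
        quadPeriod n₁ (-1) x₁ * quadPeriod n₂ 1 x₂) = 0 := by
  obtain ⟨c₁, hc₁⟩ := exists_four_mul_eq ho₁
  obtain ⟨c₂, hc₂⟩ := exists_four_mul_eq ho₂
  have s₁ := quadPeriod_add_of_isPrimitiveRoot h₁
  have s₂ := quadPeriod_add_of_isPrimitiveRoot h₂
  have t₁ := quadPeriod_mul_quadPeriod ho₁ h₁ hc₁
  have t₂ := quadPeriod_mul_quadPeriod ho₂ h₂ hc₂
  have hC : 4 * (c₁ + c₂ - 4 * c₁ * c₂) = 1 - ZMod.χ₄ (n₁ * n₂ : ℕ) * (n₁ * n₂ : ℕ) := by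
    rw [← quadraticChar_neg_one_mul ho₁ ho₂]
    push_cast
    linear_combination (1 - 4 * c₂) * hc₁ + quadraticChar (ZMod n₁) (-1) * n₁ * hc₂
  have hdvd : (p : ℤ) ∣ c₁ + c₂ - 4 * c₁ * c₂ := by
    rcases hcase with ⟨hm, hp⟩ | ⟨hm, hp⟩
    · rw [ZMod.χ₄_nat_three_mod_four (by omega)] at hC
      have : c₁ + c₂ - 4 * c₁ * c₂ = ((n₁ * n₂ + 1) / 4 : ℕ) := by omega
      rw [this]
      exact_mod_cast hp
    · rw [ZMod.χ₄_nat_one_mod_four (by omega)] at hC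
      have : c₁ + c₂ - 4 * c₁ * c₂ = -((n₁ * n₂ - 1) / 4 : ℕ) := by omega
      rw [this, dvd_neg]
      exact_mod_cast hp
  have hzero : (c₁ + c₂ - 4 * c₁ * c₂ : K) = 0 := by
    have := (CharP.intCast_eq_zero_iff K p _).mpr hdvd
    exact_mod_cast this
  generalize quadPeriod n₁ 1 x₁ = A at *
  generalize quadPeriod n₁ (-1) x₁ = A' at *
  generalize quadPeriod n₂ 1 x₂ = B at *
  generalize quadPeriod n₂ (-1) x₂ = B' at *
  obtain rfl : A' = -1 - A := by linear_combination s₁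
  obtain rfl : B' = -1 - B := by linear_combination s₂
  refine ⟨by ring, ?_⟩
  rw [← hzero, ← t₁, ← t₂]
  ring

end CRT

section Roots

variable {E : Type*} [Field E] {n : ℕ} [NeZero n] {β : E}

lemma X_pow_sub_one_eq_prod_zmod (hβ : IsPrimitiveRoot β n) :
    (X ^ n - 1 : E[X]) = ∏ k : ZMod n, (X - C (β ^ k.val)) := by
  rw [X_pow_sub_one_eq_prod (NeZero.pos n) hβ]
  symm
  refine Finset.prod_bij (fun k _ => β ^ k.val) ?_ ?_ ?_ (fun _ _ => rfl)
  · intro k _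
    rw [mem_nthRootsFinset (NeZero.pos n), ← pow_mul, mul_comm, pow_mul, hβ.pow_eq_one, one_pow]
  · intro a _ b _ h
    exact ZMod.val_injective n (hβ.pow_inj a.val_lt b.val_lt h)
  · intro x hx
    rw [mem_nthRootsFinset (NeZero.pos n)] at hx
    obtain ⟨i, hi, rfl⟩ := hβ.eq_pow_of_pow_eq_one hx
    exact ⟨i, Finset.mem_univ _, by rw [ZMod.val_cast_of_lt hi]⟩

lemma eq_prod_of_dvd_X_pow_sub_one (hβ : IsPrimitiveRoot β n) {D : E[X]} (hm : D.Monic)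
    (hd : D ∣ X ^ n - 1) {S : Finset (ZMod n)} (hS : ∀ k : ZMod n, D.eval (β ^ k.val) = 0 ↔ k ∈ S) :
    D = ∏ k ∈ S, (X - C (β ^ k.val)) := by
  have hinj : Function.Injective fun k : ZMod n => β ^ k.val := fun a b h =>
    ZMod.val_injective n (hβ.pow_inj a.val_lt b.val_lt h)
  have h0 : (X ^ n - 1 : E[X]) ≠ 0 := Monic.ne_zero (leadingCoeff_X_pow_sub_one (NeZero.pos n))
  have hprod := X_pow_sub_one_eq_prod_zmod hβ
  have hroots : (X ^ n - 1 : E[X]).roots = Finset.univ.val.map fun k : ZMod n => β ^ k.val := by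
    rw [hprod, ← roots_multiset_prod_X_sub_C (Finset.univ.val.map _), Multiset.map_map]
    rfl
  have hsplit : (X ^ n - 1 : E[X]).Splits := by
    rw [hprod]
    exact Splits.prod fun k _ => Splits.X_sub_C _
  have hle := roots.le_of_dvd h0 hd
  have hDroots : D.roots = S.val.map fun k : ZMod n => β ^ k.val := by
    refine (Multiset.Nodup.ext (Multiset.nodup_of_le hle ?_) (S.nodup.map hinj)).mpr fun x => ?_
    · rw [hroots]
      exact Finset.univ.nodup.map hinj
    · rw [mem_roots hm.ne_zero, IsRoot.def, Multiset.mem_map]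
      constructor
      · intro hx
        have := Multiset.mem_of_le hle ((mem_roots hm.ne_zero).mpr hx)
        rw [hroots, Multiset.mem_map] at this
        obtain ⟨k, _, rfl⟩ := this
        exact ⟨k, (hS k).mp hx, rfl⟩
      · rintro ⟨k, hk, rfl⟩
        exact (hS k).mpr hk
  rw [(hsplit.of_dvd h0 hd).eq_prod_roots_of_monic hm, hDroots, Multiset.map_map]
  rfl

lemma map_gcd_eval_eq_zero_iff {F : Type*} [Field F] [DecidableEq F] (φ : F →+* E) {A B : F[X]}
    (x : E) : ((gcd A B).map φ).eval x = 0 ↔ A.eval₂ φ x = 0 ∧ B.eval₂ φ x = 0 := by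
  rw [eval_map, ← root_gcd_iff_root_left_right]
  have h₁ : gcd A B ∣ EuclideanDomain.gcd A B :=
    EuclideanDomain.dvd_gcd (gcd_dvd_left _ _) (gcd_dvd_right _ _)
  have h₂ : EuclideanDomain.gcd A B ∣ gcd A B :=
    dvd_gcd (EuclideanDomain.gcd_dvd_left _ _) (EuclideanDomain.gcd_dvd_right _ _)
  exact ⟨eval₂_eq_zero_of_dvd_of_eval₂_eq_zero φ x h₁,
    eval₂_eq_zero_of_dvd_of_eval₂_eq_zero φ x h₂⟩

lemma monic_gcd_X_pow_sub_one {F : Type*} [Field F] [DecidableEq F] {n : ℕ} (hn : 0 < n)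
    (B : F[X]) : (gcd (X ^ n - 1) B).Monic := by
  rw [← normalize_gcd]
  refine monic_normalize fun h => Monic.ne_zero (leadingCoeff_X_pow_sub_one (R := F) hn) ?_
  exact zero_dvd_iff.mp (h ▸ gcd_dvd_left _ B)

variable {n₁ n₂ : ℕ} [Fact n₁.Prime] [Fact n₂.Prime]

lemma X_pow_sub_one_eq_prod_filter_left {β : E} (hβ : IsPrimitiveRoot β (n₁ * n₂)) :
    (X ^ n₂ - 1 : E[X]) =
      ∏ k : ZMod (n₁ * n₂) with (k.val : ZMod n₁) = 0, (X - C (β ^ k.val)) := by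
  refine eq_prod_of_dvd_X_pow_sub_one hβ
    (leadingCoeff_X_pow_sub_one (Fact.out : n₂.Prime).pos) ?_ fun k => ?_
  · rw [mul_comm n₁, pow_mul]
    exact sub_one_dvd_pow_sub_one _ _
  · simp only [eval_sub, eval_pow, eval_X, eval_one, sub_eq_zero, Finset.mem_filter,
      Finset.mem_univ, true_and, ZMod.natCast_eq_zero_iff, ← pow_mul, hβ.pow_eq_one_iff_dvd]
    exact Nat.mul_dvd_mul_iff_right (Fact.out : n₂.Prime).pos

lemma X_pow_sub_one_eq_prod_filter_right {β : E} (hβ : IsPrimitiveRoot β (n₁ * n₂)) :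
    (X ^ n₁ - 1 : E[X]) =
      ∏ k : ZMod (n₁ * n₂) with (k.val : ZMod n₂) = 0, (X - C (β ^ k.val)) := by
  refine eq_prod_of_dvd_X_pow_sub_one hβ
    (leadingCoeff_X_pow_sub_one (Fact.out : n₁.Prime).pos) ?_ fun k => ?_
  · rw [pow_mul]
    exact sub_one_dvd_pow_sub_one _ _
  · simp only [eval_sub, eval_pow, eval_X, eval_one, sub_eq_zero, Finset.mem_filter,
      Finset.mem_univ, true_and, ZMod.natCast_eq_zero_iff, ← pow_mul, hβ.pow_eq_one_iff_dvd]
    generalize k.val = j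
    rw [mul_comm n₁]
    exact Nat.mul_dvd_mul_iff_right (Fact.out : n₁.Prime).pos

lemma X_sub_one_eq_prod_filter (h : n₁.Coprime n₂) {β : E} :
    (X - 1 : E[X]) = ∏ k : ZMod (n₁ * n₂) with (k.val : ZMod n₁) = 0 ∧ (k.val : ZMod n₂) = 0,
      (X - C (β ^ k.val)) := by
  have : ({k : ZMod (n₁ * n₂) | (k.val : ZMod n₁) = 0 ∧ (k.val : ZMod n₂) = 0} : Finset _) =
      {0} := by
    ext k
    simp only [Finset.mem_filter, Finset.mem_univ, true_and, ZMod.natCast_eq_zero_iff,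
      Finset.mem_singleton]
    refine ⟨fun hk => ?_, fun hk => by simp [hk]⟩
    rw [← ZMod.natCast_zmod_val k, ZMod.natCast_eq_zero_iff]
    exact h.mul_dvd_of_dvd_of_dvd hk.1 hk.2
  rw [this, Finset.prod_singleton, ZMod.val_zero, pow_zero, C_1]

lemma not_mem_jacobiClass_of_eq_zero {ε : ℤ} (hε : ε ≠ 0) {k : ZMod (n₁ * n₂)}
    (hk : (k.val : ZMod n₁) = 0 ∨ (k.val : ZMod n₂) = 0) : k ∉ jacobiClass n₁ n₂ ε := by
  intro h
  simp only [jacobiClass, Finset.mem_filter, Finset.mem_univ, true_and] at h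
  rcases hk with hk | hk <;> rw [hk, MulChar.map_zero] at h <;> simp at h <;> omega

/-- A monic divisor of `X ^ (n₁ * n₂) - 1` whose roots are prescribed on each of the orbits of
the exponents. -/
lemma monic_dvd_eq_of_eval_eq_zero_iff (h : n₁.Coprime n₂) {β : E}
    (hβ : IsPrimitiveRoot β (n₁ * n₂)) {D : E[X]} (hm : D.Monic) (hd : D ∣ X ^ (n₁ * n₂) - 1)
    {ε : ℤ} (hε : ε ≠ 0) {δ δ₁ δ₂ : Prop} (hδ₁ : δ₁ → δ) (hδ₂ : δ₂ → δ)
    (hD : ∀ k : ZMod (n₁ * n₂), D.eval (β ^ k.val) = 0 ↔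
      ((k.val : ZMod n₁) = 0 ∧ (k.val : ZMod n₂) = 0 ∧ δ) ∨
      ((k.val : ZMod n₁) = 0 ∧ (k.val : ZMod n₂) ≠ 0 ∧ δ₁) ∨
      ((k.val : ZMod n₁) ≠ 0 ∧ (k.val : ZMod n₂) = 0 ∧ δ₂) ∨ k ∈ jacobiClass n₁ n₂ ε) :
    (¬ δ₁ → ¬ δ₂ → ¬ δ → D = ∏ k ∈ jacobiClass n₁ n₂ ε, (X - C (β ^ k.val))) ∧
    (¬ δ₁ → ¬ δ₂ → δ → D = (X - 1) * ∏ k ∈ jacobiClass n₁ n₂ ε, (X - C (β ^ k.val))) ∧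
    (δ₁ → ¬ δ₂ → D = (X ^ n₂ - 1) * ∏ k ∈ jacobiClass n₁ n₂ ε, (X - C (β ^ k.val))) ∧
    (¬ δ₁ → δ₂ → D = (X ^ n₁ - 1) * ∏ k ∈ jacobiClass n₁ n₂ ε, (X - C (β ^ k.val))) ∧
    (δ₁ → δ₂ → D * (X - 1) = (X ^ n₁ - 1) * (X ^ n₂ - 1) *
      ∏ k ∈ jacobiClass n₁ n₂ ε, (X - C (β ^ k.val))) := by
  have hdisj : ∀ S : Finset (ZMod (n₁ * n₂)),
      (∀ k ∈ S, (k.val : ZMod n₁) = 0 ∨ (k.val : ZMod n₂) = 0) →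
      Disjoint S (jacobiClass n₁ n₂ ε) := fun S hS =>
    Finset.disjoint_left.mpr fun k hk => not_mem_jacobiClass_of_eq_zero hε (hS k hk)
  refine ⟨fun h₁ h₂ h₀ => ?_, fun h₁ h₂ h₀ => ?_, fun h₁ h₂ => ?_, fun h₁ h₂ => ?_,
    fun h₁ h₂ => ?_⟩
  · refine eq_prod_of_dvd_X_pow_sub_one hβ hm hd fun k => ?_
    simp only [hD, h₁, h₂, h₀, and_false, false_or]
  · rw [X_sub_one_eq_prod_filter h (β := β), ← Finset.prod_union (hdisj _ (by simp +contextual))]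
    refine eq_prod_of_dvd_X_pow_sub_one hβ hm hd fun k => ?_
    simp only [hD, h₁, h₂, h₀, and_false, false_or, and_true, Finset.mem_union,
      Finset.mem_filter, Finset.mem_univ, true_and]
  · rw [X_pow_sub_one_eq_prod_filter_left hβ, ← Finset.prod_union (hdisj _ (by simp +contextual))]
    refine eq_prod_of_dvd_X_pow_sub_one hβ hm hd fun k => ?_
    simp only [hD, h₁, h₂, hδ₁ h₁, and_false, false_or, and_true, Finset.mem_union,
      Finset.mem_filter, Finset.mem_univ, true_and]
    tauto
  · rw [X_pow_sub_one_eq_prod_filter_right hβ, ← Finset.prod_union (hdisj _ (by simp +contextual))]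
    refine eq_prod_of_dvd_X_pow_sub_one hβ hm hd fun k => ?_
    simp only [hD, h₁, h₂, hδ₂ h₂, and_false, false_or, and_true, Finset.mem_union,
      Finset.mem_filter, Finset.mem_univ, true_and]
    tauto
  · rw [X_pow_sub_one_eq_prod_filter_right hβ, X_pow_sub_one_eq_prod_filter_left hβ,
      mul_comm (∏ _ ∈ _, _) (∏ _ ∈ _, _), X_sub_one_eq_prod_filter h (β := β), Finset.filter_and,
      ← Finset.prod_union_inter,
      mul_right_comm, ← Finset.prod_union (hdisj _ ?_)]
    · congr 1
      refine eq_prod_of_dvd_X_pow_sub_one hβ hm hd fun k => ?_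
      simp only [hD, h₁, h₂, hδ₂ h₂, and_true, Finset.mem_union,
        Finset.mem_filter, Finset.mem_univ, true_and]
      tauto
    · simp only [Finset.mem_union, Finset.mem_filter, Finset.mem_univ, true_and]
      exact fun k hk => hk

end Roots

section Evaluation

variable {n₁ n₂ : ℕ} [Fact n₁.Prime] [Fact n₂.Prime]

lemma exists_mul_eq_of_isPrimitiveRoot_mul {K : Type*} [CommRing K] (h : n₁.Coprime n₂) {β : K}
    (hβ : IsPrimitiveRoot β (n₁ * n₂)) :
    ∃ x₁ x₂, x₁ * x₂ = β ∧ IsPrimitiveRoot x₁ n₁ ∧ IsPrimitiveRoot x₂ n₂ := by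
  obtain ⟨r, hr₁, hr₂⟩ := Nat.chineseRemainder h 1 0
  obtain ⟨s, hs₁, hs₂⟩ := Nat.chineseRemainder h 0 1
  have hrs : r + s ≡ 1 [MOD n₁ * n₂] :=
    (Nat.modEq_and_modEq_iff_modEq_mul h).mp ⟨hr₁.add hs₁, hr₂.add hs₂⟩
  have hmul : β ^ r * β ^ s = β := by
    rw [← pow_add, pow_eq_pow_of_modEq hrs hβ.pow_eq_one, pow_one]
  have h₁ : (β ^ r) ^ n₁ = 1 := by
    rw [← pow_mul, hβ.pow_eq_one_iff_dvd, mul_comm r]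
    exact mul_dvd_mul_left n₁ ((Nat.modEq_zero_iff_dvd).mp hr₂)
  have h₂ : (β ^ s) ^ n₂ = 1 := by
    rw [← pow_mul, hβ.pow_eq_one_iff_dvd]
    exact mul_dvd_mul_right ((Nat.modEq_zero_iff_dvd).mp hs₁) n₂
  refine ⟨β ^ r, β ^ s, hmul, ⟨h₁, fun l hl => ?_⟩, ⟨h₂, fun l hl => ?_⟩⟩
  · have : β ^ (l * n₂) = 1 := by
      rw [← hmul, mul_pow, pow_mul, hl, one_pow, one_mul, mul_comm, pow_mul, h₂, one_pow]
    exact Nat.dvd_of_mul_dvd_mul_right (Fact.out : n₂.Prime).pos (hβ.dvd_of_pow_eq_one _ this)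
  · have : β ^ (n₁ * l) = 1 := by
      rw [← hmul, mul_pow, pow_mul, h₁, one_pow, one_mul, mul_comm, pow_mul, hl, one_pow]
    exact Nat.dvd_of_mul_dvd_mul_left (Fact.out : n₁.Prime).pos (hβ.dvd_of_pow_eq_one _ this)

lemma isPrimitiveRoot_pow_of_natCast_ne_zero {K : Type*} [CommRing K] {ℓ : ℕ} [Fact ℓ.Prime]
    {x : K} (hx : IsPrimitiveRoot x ℓ) {k : ℕ} (hk : (k : ZMod ℓ) ≠ 0) :
    IsPrimitiveRoot (x ^ k) ℓ := by
  refine hx.pow_of_coprime k (((Fact.out : ℓ.Prime).coprime_iff_not_dvd.mpr ?_).symm)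
  rwa [← ZMod.natCast_eq_zero_iff]

lemma pow_eq_one_of_natCast_eq_zero {K : Type*} [CommRing K] {ℓ : ℕ}
    {x : K} (hx : x ^ ℓ = 1) {k : ℕ} (hk : (k : ZMod ℓ) = 0) : x ^ k = 1 := by
  obtain ⟨j, rfl⟩ := (ZMod.natCast_eq_zero_iff _ _).mp hk
  rw [pow_mul, hx, one_pow]

lemma sum_sequenceSupport_pow {K : Type*} [CommRing K] [IsDomain K] (p : ℕ) [CharP K p]
    (h : n₁.Coprime n₂) (ho₁ : Odd n₁) (ho₂ : Odd n₂)
    (hcase : (n₁ * n₂ % 12 = 7 ∧ p ∣ (n₁ * n₂ + 1) / 4) ∨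
      (n₁ * n₂ % 12 = 1 ∧ p ∣ (n₁ * n₂ - 1) / 4))
    {β : K} (hβ : IsPrimitiveRoot β (n₁ * n₂)) {v : ℕ → K}
    (hv : ∀ k, v k = ∑ i ∈ sequenceSupport n₁ n₂, (β ^ k) ^ i.val) :
    (v 1 = 0 ∨ v 1 = -1) ∧
    (∀ k : ℕ, (k : ZMod n₁) = 0 → (k : ZMod n₂) = 0 → v k = ((n₁ + 1) * (n₂ - 1) / 2 : ℕ)) ∧
    (∀ k : ℕ, (k : ZMod n₁) = 0 → (k : ZMod n₂) ≠ 0 → v k = -((n₁ + 1) / 2 : ℕ)) ∧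
    (∀ k : ℕ, (k : ZMod n₁) ≠ 0 → (k : ZMod n₂) = 0 → v k = ((n₂ - 1) / 2 : ℕ)) ∧
    (∀ k : ℕ, quadraticChar (ZMod n₁) k * quadraticChar (ZMod n₂) k = 1 → v k = v 1) ∧
    (∀ k : ℕ, quadraticChar (ZMod n₁) k * quadraticChar (ZMod n₂) k = -1 → v k = -1 - v 1) := by
  obtain ⟨x₁, x₂, rfl, h₁, h₂⟩ := exists_mul_eq_of_isPrimitiveRoot_mul h hβ
  replace hv : ∀ k, v k = _ := fun k => by
    rw [hv, mul_pow, sum_sequenceSupport h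
      (by rw [← pow_mul, mul_comm, pow_mul, h₁.pow_eq_one, one_pow])
      (by rw [← pow_mul, mul_comm, pow_mul, h₂.pow_eq_one, one_pow])]
  obtain ⟨hadd, hmul⟩ := jacobiPeriod_add_mul p ho₁ ho₂ hcase h₁ h₂
  have s₁ := quadPeriod_add_of_isPrimitiveRoot h₁
  have s₂ := quadPeriod_add_of_isPrimitiveRoot h₂
  have e₁ := hv 1
  rw [pow_one, pow_one] at e₁
  obtain ⟨m₁, hm₁⟩ := id ho₁
  obtain ⟨m₂, hm₂⟩ := id ho₂
  have d₁ : (n₁ - 1) / 2 = m₁ := by omega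
  have d₁' : (n₁ + 1) / 2 = m₁ + 1 := by omega
  have d₂ : (n₂ - 1) / 2 = m₂ := by omega
  have d : (n₁ + 1) * (n₂ - 1) / 2 = 2 * m₂ * (m₁ + 1) := by
    rw [hm₁, hm₂, Nat.add_sub_cancel]
    exact Nat.div_eq_of_eq_mul_left two_pos (by ring)
  refine ⟨?_, fun k k₁ k₂ => ?_, fun k k₁ k₂ => ?_, fun k k₁ k₂ => ?_, fun k hk => ?_,
    fun k hk => ?_⟩
  · rcases mul_eq_zero.mp hmul with h0 | h0
    · left
      linear_combination e₁ + hadd - h0 + s₂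
    · right
      linear_combination e₁ + h0 + s₂
  · rw [hv, pow_eq_one_of_natCast_eq_zero h₁.pow_eq_one k₁,
      pow_eq_one_of_natCast_eq_zero h₂.pow_eq_one k₂, quadPeriod_one ho₁ (Or.inl rfl),
      quadPeriod_one ho₁ (Or.inr rfl), quadPeriod_one ho₂ (Or.inl rfl),
      quadPeriod_one ho₂ (Or.inr rfl), d₁, d₂, d]
    push_cast
    ring
  · have s := quadPeriod_add_of_isPrimitiveRoot (isPrimitiveRoot_pow_of_natCast_ne_zero h₂ k₂)
    rw [hv, pow_eq_one_of_natCast_eq_zero h₁.pow_eq_one k₁, quadPeriod_one ho₁ (Or.inl rfl),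
      quadPeriod_one ho₁ (Or.inr rfl), d₁, d₁']
    push_cast
    linear_combination (1 + (m₁ : K)) * s
  · have s := quadPeriod_add_of_isPrimitiveRoot (isPrimitiveRoot_pow_of_natCast_ne_zero h₁ k₁)
    rw [hv, pow_eq_one_of_natCast_eq_zero h₂.pow_eq_one k₂, quadPeriod_one ho₂ (Or.inl rfl),
      quadPeriod_one ho₂ (Or.inr rfl), d₂]
    linear_combination (m₂ : K) * s
  · rw [hv, e₁]
    rcases Int.mul_eq_one_iff_eq_one_or_neg_one.mp hk with ⟨q₁, q₂⟩ | ⟨q₁, q₂⟩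
    · rw [quadPeriod_pow h₁.pow_eq_one q₁ (by simp), quadPeriod_pow h₁.pow_eq_one q₁ (by simp),
        quadPeriod_pow h₂.pow_eq_one q₂ (by simp), quadPeriod_pow h₂.pow_eq_one q₂ (by simp)]
      norm_num
    · rw [quadPeriod_pow h₁.pow_eq_one q₁ (by simp), quadPeriod_pow h₁.pow_eq_one q₁ (by simp),
        quadPeriod_pow h₂.pow_eq_one q₂ (by simp), quadPeriod_pow h₂.pow_eq_one q₂ (by simp)]
      norm_num
      ring
  · rw [hv, e₁]
    rcases Int.mul_eq_neg_one_iff_eq_one_or_neg_one.mp hk with ⟨q₁, q₂⟩ | ⟨q₁, q₂⟩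
    · rw [quadPeriod_pow h₁.pow_eq_one q₁ (by simp), quadPeriod_pow h₁.pow_eq_one q₁ (by simp),
        quadPeriod_pow h₂.pow_eq_one q₂ (by simp), quadPeriod_pow h₂.pow_eq_one q₂ (by simp)]
      norm_num
      linear_combination hadd + 2 * s₂
    · rw [quadPeriod_pow h₁.pow_eq_one q₁ (by simp), quadPeriod_pow h₁.pow_eq_one q₁ (by simp),
        quadPeriod_pow h₂.pow_eq_one q₂ (by simp), quadPeriod_pow h₂.pow_eq_one q₂ (by simp)]
      norm_num
      linear_combination hadd + 2 * s₂

end Evaluation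

section Whiteman

variable {n₁ n₂ : ℕ} [Fact n₁.Prime] [Fact n₂.Prime]

lemma natCast_val_natCast_of_dvd {m n : ℕ} (h : m ∣ n) (k : ℕ) :
    (((k : ZMod n).val : ℕ) : ZMod m) = k := by
  rw [ZMod.val_natCast, ZMod.natCast_eq_natCast_iff]
  exact (Nat.mod_modEq k n).of_dvd h

lemma quadraticChar_eq_neg_one_of_orderOf {ℓ : ℕ} [Fact ℓ.Prime] (hℓ : Odd ℓ) {g : ZMod ℓ}
    (hg : orderOf g = ℓ - 1) : quadraticChar (ZMod ℓ) g = -1 := by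
  have h2 := (Fact.out : ℓ.Prime).two_le
  have hne2 : ℓ ≠ 2 := by
    rintro rfl
    exact absurd hℓ (by decide)
  have hg0 : g ≠ 0 := by
    rintro rfl
    rw [orderOf_zero] at hg
    omega
  refine (quadraticChar_dichotomy hg0).resolve_left fun h => ?_
  have hpow := quadraticChar_eq_pow_of_char_ne_two' (by rwa [ZMod.ringChar_zmod_n]) g
  rw [h, Int.cast_one, ZMod.card] at hpow
  have hdvd := orderOf_dvd_of_pow_eq_one hpow.symm
  rw [hg] at hdvd
  have := Nat.le_of_dvd (by omega) hdvd
  omega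

lemma exists_pow_eq_of_orderOf {ℓ : ℕ} [Fact ℓ.Prime] {g : ZMod ℓ} (hg : orderOf g = ℓ - 1)
    {x : ZMod ℓ} (hx : x ≠ 0) : ∃ a, g ^ a = x := by
  have hpos : 0 < ℓ - 1 := Nat.sub_pos_of_lt (Fact.out : ℓ.Prime).one_lt
  have : NeZero (ℓ - 1) := ⟨hpos.ne'⟩
  have hprim : IsPrimitiveRoot g (ℓ - 1) := hg ▸ IsPrimitiveRoot.orderOf g
  obtain ⟨i, _, hi⟩ := hprim.eq_pow_of_pow_eq_one (ZMod.pow_card_sub_one_eq_one hx)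
  exact ⟨i, hi⟩

variable {g u : ℕ}

lemma quadraticChar_mul_quadraticChar_whiteman (ho₁ : Odd n₁) (ho₂ : Odd n₂)
    (hg₁ : orderOf (g : ZMod n₁) = n₁ - 1) (hg₂ : orderOf (g : ZMod n₂) = n₂ - 1)
    (hu₁ : (u : ZMod n₁) = g) (hu₂ : (u : ZMod n₂) = 1) (s i : ℕ) {x : ZMod (n₁ * n₂)}
    (hx : x = (g : ZMod (n₁ * n₂)) ^ s * (u : ZMod (n₁ * n₂)) ^ i) :
    quadraticChar (ZMod n₁) x.val * quadraticChar (ZMod n₂) x.val = (-1) ^ i := by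
  have hx' : x = ((g ^ s * u ^ i : ℕ) : ZMod (n₁ * n₂)) := by push_cast; exact hx
  rw [hx', natCast_val_natCast_of_dvd (dvd_mul_right _ _),
    natCast_val_natCast_of_dvd (dvd_mul_left _ _)]
  push_cast
  rw [hu₁, hu₂, one_pow, mul_one, map_mul, map_pow, map_pow, map_pow,
    quadraticChar_eq_neg_one_of_orderOf ho₁ hg₁, quadraticChar_eq_neg_one_of_orderOf ho₂ hg₂,
    mul_right_comm, ← mul_pow]
  norm_num

lemma exists_whiteman_index (h : n₁.Coprime n₂) (h6 : Nat.gcd (n₁ - 1) (n₂ - 1) = 6)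
    (hg₁ : orderOf (g : ZMod n₁) = n₁ - 1) (hg₂ : orderOf (g : ZMod n₂) = n₂ - 1)
    (hu₁ : (u : ZMod n₁) = g) (hu₂ : (u : ZMod n₂) = 1) {x : ZMod (n₁ * n₂)}
    (hx₁ : (x.val : ZMod n₁) ≠ 0) (hx₂ : (x.val : ZMod n₂) ≠ 0) :
    ∃ i < 6, ∃ s < (n₁ - 1) * (n₂ - 1) / 6,
      x = (g : ZMod (n₁ * n₂)) ^ s * (u : ZMod (n₁ * n₂)) ^ i := by
  obtain ⟨a, ha⟩ := exists_pow_eq_of_orderOf hg₁ hx₁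
  obtain ⟨b, hb⟩ := exists_pow_eq_of_orderOf hg₂ hx₂
  have hd₁ : 6 ∣ n₁ - 1 := h6 ▸ Nat.gcd_dvd_left _ _
  have hpos₁ : n₁ - 1 ≠ 0 := Nat.sub_ne_zero_of_lt (Fact.out : n₁.Prime).one_lt
  have hpos₂ : n₂ - 1 ≠ 0 := Nat.sub_ne_zero_of_lt (Fact.out : n₂.Prime).one_lt
  obtain ⟨i, hi⟩ : ∃ i, i = (a + 5 * b) % 6 := ⟨_, rfl⟩
  have hi6 : i < 6 := hi ▸ Nat.mod_lt _ (by norm_num)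
  have hcong : a + (n₁ - 1) - i ≡ b [MOD (n₁ - 1).gcd (n₂ - 1)] := by
    rw [h6, Nat.ModEq]
    omega
  have hlt := Nat.chineseRemainder'_lt_lcm hcong hpos₁ hpos₂
  obtain ⟨hs₁, hs₂⟩ := (Nat.chineseRemainder' hcong).2
  generalize (Nat.chineseRemainder' hcong : ℕ) = s at hlt hs₁ hs₂
  refine ⟨i, hi6, s, by rwa [Nat.lcm, h6] at hlt, ?_⟩
  have hs₁' : s + i ≡ a [MOD n₁ - 1] := by
    have := hs₁.add_right i
    rw [Nat.sub_add_cancel (by omega)] at this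
    exact this.trans (by simp [Nat.ModEq])
  have hx : x = ((x.val : ℕ) : ZMod (n₁ * n₂)) := (ZMod.natCast_zmod_val x).symm
  rw [hx, ← Nat.cast_pow, ← Nat.cast_pow, ← Nat.cast_mul, ZMod.natCast_eq_natCast_iff,
    ← Nat.modEq_and_modEq_iff_modEq_mul h, ← ZMod.natCast_eq_natCast_iff,
    ← ZMod.natCast_eq_natCast_iff, ← ha, ← hb]
  push_cast
  rw [hu₁, hu₂, one_pow, mul_one, ← pow_add]
  exact ⟨(pow_eq_pow_of_modEq hs₁' (hg₁ ▸ pow_orderOf_eq_one _)).symm,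
    (pow_eq_pow_of_modEq hs₂ (hg₂ ▸ pow_orderOf_eq_one _)).symm⟩

lemma whiteman_union_eq_jacobiClass (h : n₁.Coprime n₂) (ho₁ : Odd n₁) (ho₂ : Odd n₂)
    (h6 : Nat.gcd (n₁ - 1) (n₂ - 1) = 6)
    (hg₁ : orderOf (g : ZMod n₁) = n₁ - 1) (hg₂ : orderOf (g : ZMod n₂) = n₂ - 1)
    (hu₁ : (u : ZMod n₁) = g) (hu₂ : (u : ZMod n₂) = 1) {W : ℕ → Finset (ZMod (n₁ * n₂))}
    (hW : ∀ i x, x ∈ W i ↔ ∃ s < (n₁ - 1) * (n₂ - 1) / 6,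
      x = (g : ZMod (n₁ * n₂)) ^ s * (u : ZMod (n₁ * n₂)) ^ i) :
    W 0 ∪ W 2 ∪ W 4 = jacobiClass n₁ n₂ 1 ∧ W 1 ∪ W 3 ∪ W 5 = jacobiClass n₁ n₂ (-1) := by
  have hmem : ∀ i x, x ∈ W i →
      quadraticChar (ZMod n₁) x.val * quadraticChar (ZMod n₂) x.val = (-1) ^ i := by
    intro i x hx
    obtain ⟨s, _, hs⟩ := (hW i x).mp hx
    exact quadraticChar_mul_quadraticChar_whiteman ho₁ ho₂ hg₁ hg₂ hu₁ hu₂ s i hs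
  have hex : ∀ x : ZMod (n₁ * n₂),
      quadraticChar (ZMod n₁) x.val * quadraticChar (ZMod n₂) x.val ≠ 0 → ∃ i < 6, x ∈ W i := by
    intro x hx
    obtain ⟨i, hi, hs⟩ := exists_whiteman_index h h6 hg₁ hg₂ hu₁ hu₂ (x := x)
      (fun h0 => hx (by rw [h0, MulChar.map_zero, zero_mul]))
      (fun h0 => hx (by rw [h0, MulChar.map_zero, mul_zero]))
    exact ⟨i, hi, (hW i x).mpr hs⟩
  constructor <;>
  · ext x
    simp only [jacobiClass, Finset.mem_union, Finset.mem_filter, Finset.mem_univ, true_and]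
    constructor
    · rintro ((hx | hx) | hx) <;> simpa using hmem _ x hx
    · intro hx
      obtain ⟨i, hi, hxi⟩ := hex x (by rw [hx]; norm_num)
      have := hmem i x hxi
      rw [hx] at this
      interval_cases i <;> norm_num at this <;> simp [hxi]

lemma mem_multiples_iff (h : n₁.Coprime n₂) (x : ZMod (n₁ * n₂)) :
    (∃ k : ℕ, 1 ≤ k ∧ k ≤ n₂ - 1 ∧ x = ((k * n₁ : ℕ) : ZMod (n₁ * n₂))) ↔
      (x.val : ZMod n₁) = 0 ∧ (x.val : ZMod n₂) ≠ 0 := by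
  have hp₁ := (Fact.out : n₁.Prime)
  have hp₂ := (Fact.out : n₂.Prime)
  constructor
  · rintro ⟨k, hk₁, hk₂, rfl⟩
    rw [natCast_val_natCast_of_dvd (dvd_mul_right _ _),
      natCast_val_natCast_of_dvd (dvd_mul_left _ _), ne_eq, ZMod.natCast_eq_zero_iff,
      ZMod.natCast_eq_zero_iff]
    refine ⟨dvd_mul_left _ _, fun hdvd => ?_⟩
    have := Nat.le_of_dvd hk₁ (h.symm.dvd_of_dvd_mul_right hdvd)
    have := hp₂.one_lt
    omega
  · rw [ne_eq, ZMod.natCast_eq_zero_iff, ZMod.natCast_eq_zero_iff]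
    rintro ⟨⟨k, hk⟩, hx⟩
    have hlt := x.val_lt
    rw [hk] at hlt
    have hlt := Nat.lt_of_mul_lt_mul_left hlt
    refine ⟨k, Nat.one_le_iff_ne_zero.mpr ?_, by omega, ?_⟩
    · rintro rfl
      exact hx (by simp [hk])
    · rw [mul_comm k, ← hk, ZMod.natCast_zmod_val]

end Whiteman

theorem stmt_15
    (n₁ n₂ n e g u : ℕ)
    (hp₁ : n₁.Prime) (hp₂ : n₂.Prime)
    (hodd₁ : Odd n₁) (hodd₂ : Odd n₂) (hne : n₁ ≠ n₂)
    (h6 : Nat.gcd (n₁ - 1) (n₂ - 1) = 6)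
    (hn : n = n₁ * n₂)
    (he : e = (n₁ - 1) * (n₂ - 1) / 6)
    (hg₁ : orderOf (g : ZMod n₁) = n₁ - 1)
    (hg₂ : orderOf (g : ZMod n₂) = n₂ - 1)
    (hu₁ : (u : ZMod n₁) = (g : ZMod n₁))
    (hu₂ : (u : ZMod n₂) = 1)
    (W : ℕ → Finset (ZMod n))
    (hW : ∀ i, (W i : Set (ZMod n)) =
      {x | ∃ s < e, x = (g : ZMod n) ^ s * (u : ZMod n) ^ i})
    (P Q : Set (ZMod n))
    (hP : P = {x | ∃ k : ℕ, 1 ≤ k ∧ k ≤ n₂ - 1 ∧ x = ((k * n₁ : ℕ) : ZMod n)})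
    (hQ : Q = {x | ∃ k : ℕ, 1 ≤ k ∧ k ≤ n₁ - 1 ∧ x = ((k * n₂ : ℕ) : ZMod n)})
    (D₀ D₁ : Finset (ZMod n))
    (hD₀ : D₀ = W 0 ∪ W 2 ∪ W 4) (hD₁ : D₁ = W 1 ∪ W 3 ∪ W 5)
    (p a q m : ℕ) (hp : p.Prime) (ha : 0 < a) (hq : q = p ^ a)
    (hco : Nat.Coprime n q) (hm : m = orderOf (q : ZMod n))
    (F E : Type) [Field F] [Fintype F] [DecidableEq F] [CharP F p]
    [Field E] [Fintype E] [CharP E p]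
    (hF : Fintype.card F = q) (hE : Fintype.card E = q ^ m)
    (φ : F →+* E)
    (β : E) (hβ : IsPrimitiveRoot β n)
    (hcase : (n % 12 = 7 ∧ p ∣ (n + 1) / 4) ∨ (n % 12 = 1 ∧ p ∣ (n - 1) / 4))
    (C₁ : Finset (ZMod n))
    (hC₁ : (C₁ : Set (ZMod n)) = P ∪ ↑(W 1) ∪ ↑(W 3) ∪ ↑(W 5))
    (Λ : Polynomial F) (hΛ : Λ = ∑ i ∈ C₁, X ^ i.val)
    (Λβ : E) (hΛβ : Λβ = ∑ i ∈ C₁, β ^ i.val)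
    (d₀ d₁ : Polynomial E)
    (hd₀ : d₀ = ∏ i ∈ D₀, (X - C (β ^ i.val)))
    (hd₁ : d₁ = ∏ i ∈ D₁, (X - C (β ^ i.val)))
    (G : Polynomial F) (hG : G = (X ^ n - 1) / gcd (X ^ n - 1) Λ)
    (L : ℕ) (hL : L = n - (gcd (X ^ n - 1 : Polynomial F) Λ).natDegree)
    (Δ₁ Δ₂ Δ : ZMod p)
    (hΔ₁ : Δ₁ = (((n₁ + 1) / 2 : ℕ) : ZMod p))
    (hΔ₂ : Δ₂ = (((n₂ - 1) / 2 : ℕ) : ZMod p))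
    (hΔ : Δ = (((n₁ + 1) * (n₂ - 1) / 2 : ℕ) : ZMod p)) :
    (Λβ = 0 ∨ Λβ = -1) ∧
    ((Δ₁ ≠ 0 ∧ Δ₂ ≠ 0 ∧ Δ ≠ 0) →
      (Λβ = 0 → G.map φ * d₀ = X ^ n - 1) ∧
      (Λβ = -1 → G.map φ * d₁ = X ^ n - 1) ∧
      L = n - (n₁ - 1) * (n₂ - 1) / 2) ∧
    ((Δ₁ ≠ 0 ∧ Δ₂ ≠ 0 ∧ Δ = 0) →
      (Λβ = 0 → G.map φ * ((X - 1) * d₀) = X ^ n - 1) ∧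
      (Λβ = -1 → G.map φ * ((X - 1) * d₁) = X ^ n - 1) ∧
      L = n - ((n₁ - 1) * (n₂ - 1) + 2) / 2) ∧
    ((Δ₁ = 0 ∧ Δ₂ ≠ 0) →
      (Λβ = 0 → G.map φ * ((X ^ n₂ - 1) * d₀) = X ^ n - 1) ∧
      (Λβ = -1 → G.map φ * ((X ^ n₂ - 1) * d₁) = X ^ n - 1) ∧
      L = n - ((n₁ + 1) * (n₂ - 1) + 2) / 2) ∧
    ((Δ₁ ≠ 0 ∧ Δ₂ = 0) →
      (Λβ = 0 → G.map φ * ((X ^ n₁ - 1) * d₀) = X ^ n - 1) ∧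
      (Λβ = -1 → G.map φ * ((X ^ n₁ - 1) * d₁) = X ^ n - 1) ∧
      L = n - ((n₁ - 1) * (n₂ + 1) + 2) / 2) ∧
    ((Δ₁ = 0 ∧ Δ₂ = 0) →
      (Λβ = 0 → G.map φ * ((X ^ n₁ - 1) * (X ^ n₂ - 1) * d₀) = (X ^ n - 1) * (X - 1)) ∧
      (Λβ = -1 → G.map φ * ((X ^ n₁ - 1) * (X ^ n₂ - 1) * d₁) = (X ^ n - 1) * (X - 1)) ∧
      L = n - ((n₁ + 1) * (n₂ + 1) - 2) / 2) := by
  subst hn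
  have := Fact.mk hp₁
  have := Fact.mk hp₂
  have hcop : n₁.Coprime n₂ := (Nat.coprime_primes hp₁ hp₂).mpr hne
  have hnpos : 0 < n₁ * n₂ := Nat.mul_pos hp₁.pos hp₂.pos
  have hW' : ∀ i x, x ∈ W i ↔ ∃ s < (n₁ - 1) * (n₂ - 1) / 6,
      x = (g : ZMod (n₁ * n₂)) ^ s * (u : ZMod (n₁ * n₂)) ^ i := by
    intro i x
    rw [← Finset.mem_coe, hW, Set.mem_ofPred_eq, he]
  obtain ⟨hJ₀, hJ₁⟩ := whiteman_union_eq_jacobiClass hcop hodd₁ hodd₂ h6 hg₁ hg₂ hu₁ hu₂ hW'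
  rw [hJ₀] at hD₀
  rw [hJ₁] at hD₁
  obtain rfl : C₁ = sequenceSupport n₁ n₂ := by
    ext x
    rw [← Finset.mem_coe, hC₁, sequenceSupport, ← hJ₁, hP]
    simp only [Set.mem_union, Set.mem_ofPred_eq, Finset.mem_coe, Finset.mem_union,
      Finset.mem_filter, Finset.mem_univ, true_and, mem_multiples_iff hcop, or_assoc]
  obtain ⟨v, hv⟩ : ∃ v : ℕ → E, ∀ k, v k = ∑ i ∈ sequenceSupport n₁ n₂, (β ^ k) ^ i.val :=
    ⟨_, fun _ => rfl⟩
  obtain ⟨hv₁, hv00, hv01, hv10, hvpos, hvneg⟩ :=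
    sum_sequenceSupport_pow p hcop hodd₁ hodd₂ hcase hβ hv
  obtain rfl : Λβ = v 1 := by rw [hΛβ, hv, pow_one]
  have hΛeval : ∀ k, Λ.eval₂ φ (β ^ k) = v k := by
    intro k
    rw [hΛ, hv, eval₂_finsetSum]
    simp only [eval₂_X_pow]
  have hmonic := monic_gcd_X_pow_sub_one (F := F) hnpos Λ
  have hGmul : G * gcd (X ^ (n₁ * n₂) - 1) Λ = X ^ (n₁ * n₂) - 1 := by
    rw [hG, mul_comm]
    exact EuclideanDomain.mul_div_cancel' hmonic.ne_zero (gcd_dvd_left _ _)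
  generalize hDg : gcd (X ^ (n₁ * n₂) - 1) Λ = D at hmonic hGmul hL
  have hGφ : G.map φ * D.map φ = X ^ (n₁ * n₂) - 1 := by
    rw [← Polynomial.map_mul, hGmul]
    simp
  have hcast : ∀ j : ℕ, (j : E) = 0 ↔ (j : ZMod p) = 0 := fun j => by
    rw [CharP.cast_eq_zero_iff E p, ZMod.natCast_eq_zero_iff]
  have hΔeq : Δ = 2 * Δ₁ * Δ₂ := by
    obtain ⟨m₁, hm₁⟩ := hodd₁
    obtain ⟨m₂, hm₂⟩ := hodd₂
    have h₁ : (n₁ + 1) / 2 = m₁ + 1 := by omega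
    have h₂ : (n₂ - 1) / 2 = m₂ := by omega
    have h₃ : (n₁ + 1) * (n₂ - 1) / 2 = 2 * (m₁ + 1) * m₂ := by
      rw [hm₁, hm₂, Nat.add_sub_cancel]
      exact Nat.div_eq_of_eq_mul_left two_pos (by ring)
    rw [hΔ, hΔ₁, hΔ₂, h₁, h₂, h₃]
    push_cast
    ring
  have hroots : ∀ ε : ℤ, (v 1 = 0 ∧ ε = 1 ∨ v 1 = -1 ∧ ε = -1) → ∀ k : ZMod (n₁ * n₂),
      (D.map φ).eval (β ^ k.val) = 0 ↔
      ((k.val : ZMod n₁) = 0 ∧ (k.val : ZMod n₂) = 0 ∧ Δ = 0) ∨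
      ((k.val : ZMod n₁) = 0 ∧ (k.val : ZMod n₂) ≠ 0 ∧ Δ₁ = 0) ∨
      ((k.val : ZMod n₁) ≠ 0 ∧ (k.val : ZMod n₂) = 0 ∧ Δ₂ = 0) ∨ k ∈ jacobiClass n₁ n₂ ε := by
    intro ε hε k
    have hε0 : ε ≠ 0 := by omega
    have hxn : (X ^ (n₁ * n₂) - 1 : F[X]).eval₂ φ (β ^ k.val) = 0 := by
      rw [eval₂_sub, eval₂_X_pow, eval₂_one, ← pow_mul, mul_comm, pow_mul, hβ.pow_eq_one, one_pow,
        sub_self]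
    rw [← hDg, map_gcd_eval_eq_zero_iff, hΛeval, and_iff_right hxn]
    by_cases k₁ : (k.val : ZMod n₁) = 0
    · have hk := not_mem_jacobiClass_of_eq_zero hε0 (Or.inl k₁)
      by_cases k₂ : (k.val : ZMod n₂) = 0
      · simp only [k₁, k₂, hk, hv00 _ k₁ k₂, hcast, ← hΔ, true_and, ne_eq, not_true, false_and,
          or_false]
      · simp only [k₁, k₂, hk, hv01 _ k₁ k₂, neg_eq_zero, hcast, ← hΔ₁, true_and, ne_eq, not_true,
          not_false_iff, false_and, or_false, false_or]
    · by_cases k₂ : (k.val : ZMod n₂) = 0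
      · have hk := not_mem_jacobiClass_of_eq_zero hε0 (Or.inr k₂)
        simp only [k₁, k₂, hk, hv10 _ k₁ k₂, hcast, ← hΔ₂, true_and, ne_eq,
          not_false_iff, false_and, or_false, false_or]
      · simp only [k₁, k₂, false_and, and_false, false_or, jacobiClass, Finset.mem_filter,
          Finset.mem_univ, true_and]
        have hdich : quadraticChar (ZMod n₁) k.val * quadraticChar (ZMod n₂) k.val = 1 ∨
            quadraticChar (ZMod n₁) k.val * quadraticChar (ZMod n₂) k.val = -1 := by
          rcases quadraticChar_dichotomy k₁ with h | h <;>
            rcases quadraticChar_dichotomy k₂ with h' | h' <;> rw [h, h'] <;> norm_num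
        rcases hdich with hχ | hχ <;> rcases hε with ⟨hz, rfl⟩ | ⟨hz, rfl⟩
        · rw [hvpos _ hχ, hχ, hz]
          norm_num
        · rw [hvpos _ hχ, hχ, hz]
          norm_num
        · rw [hvneg _ hχ, hχ, hz]
          norm_num
        · rw [hvneg _ hχ, hχ, hz]
          norm_num
  have hcases := fun (ε : ℤ) (hε : v 1 = 0 ∧ ε = 1 ∨ v 1 = -1 ∧ ε = -1) =>
    monic_dvd_eq_of_eval_eq_zero_iff hcop hβ (hmonic.map φ) (Dvd.intro_left _ hGφ)
      (by omega : ε ≠ 0) (fun h₁ => by rw [hΔeq, h₁, mul_zero, zero_mul])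
      (fun h₂ => by rw [hΔeq, h₂, mul_zero]) (hroots ε hε)
  obtain ⟨ε, hε⟩ : ∃ ε : ℤ, (v 1 = 0 ∧ ε = 1 ∨ v 1 = -1 ∧ ε = -1) := by
    rcases hv₁ with h | h
    · exact ⟨1, Or.inl ⟨h, rfl⟩⟩
    · exact ⟨-1, Or.inr ⟨h, rfl⟩⟩
  have hzero := fun hz : v 1 = 0 => hcases 1 (Or.inl ⟨hz, rfl⟩)
  have hneg := fun hz : v 1 = -1 => hcases (-1) (Or.inr ⟨hz, rfl⟩)
  rw [← hD₀, ← hd₀] at hzero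
  rw [← hD₁, ← hd₁] at hneg
  have hdeg : (∏ k ∈ jacobiClass n₁ n₂ ε, (X - C (β ^ k.val))).natDegree =
      2 * ((n₁ - 1) / 2 * ((n₂ - 1) / 2)) := by
    rw [natDegree_finsetProd_X_sub_C_eq_card, card_jacobiClass hcop hodd₁ hodd₂ (by omega)]
  obtain ⟨h₁, h₂, h₃, h₄, h₅⟩ := hcases ε hε
  have hprod : (∏ k ∈ jacobiClass n₁ n₂ ε, (X - C (β ^ k.val))).Monic :=
    monic_prod_of_monic _ _ fun _ _ => monic_X_sub_C _
  have hXn : ∀ k : ℕ, 0 < k → (X ^ k - 1 : E[X]).Monic ∧ (X ^ k - 1 : E[X]).natDegree = k :=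
    fun k hk => ⟨by simpa using monic_X_pow_sub_C (1 : E) hk.ne',
      by simpa using natDegree_X_pow_sub_C (n := k) (r := (1 : E))⟩
  obtain ⟨hX₁, hdX₁⟩ := hXn n₁ hp₁.pos
  obtain ⟨hX₂, hdX₂⟩ := hXn n₂ hp₂.pos
  obtain ⟨hX, hdX⟩ := hXn 1 one_pos
  rw [pow_one] at hX hdX
  have hDdeg : D.natDegree = (D.map φ).natDegree := (natDegree_map φ).symm
  generalize (∏ k ∈ jacobiClass n₁ n₂ ε, (X - C (β ^ k.val))) = M at *
  obtain ⟨m₁, hm₁⟩ := hodd₁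
  obtain ⟨m₂, hm₂⟩ := hodd₂
  rw [show (n₁ - 1) / 2 = m₁ by omega, show (n₂ - 1) / 2 = m₂ by omega] at hdeg
  have hs₁ : n₁ - 1 = 2 * m₁ := by omega
  have hs₂ : n₂ - 1 = 2 * m₂ := by omega
  have ha₁ : n₁ + 1 = 2 * (m₁ + 1) := by omega
  have ha₂ : n₂ + 1 = 2 * (m₂ + 1) := by omega
  refine ⟨hv₁, ?_, ?_, ?_, ?_, ?_⟩
  · rintro ⟨t₁, t₂, t⟩
    refine ⟨fun hz => ?_, fun hz => ?_, ?_⟩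
    · rw [← (hzero hz).1 t₁ t₂ t, hGφ]
    · rw [← (hneg hz).1 t₁ t₂ t, hGφ]
    · rw [hL, hDdeg, h₁ t₁ t₂ t, hdeg, hs₁, hs₂]
      congr 1
      exact (Nat.div_eq_of_eq_mul_left two_pos (by ring)).symm
  · rintro ⟨t₁, t₂, t⟩
    refine ⟨fun hz => ?_, fun hz => ?_, ?_⟩
    · rw [← (hzero hz).2.1 t₁ t₂ t, hGφ]
    · rw [← (hneg hz).2.1 t₁ t₂ t, hGφ]
    · rw [hL, hDdeg, h₂ t₁ t₂ t, hX.natDegree_mul hprod, hdX, hdeg, hs₁, hs₂]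
      congr 1
      exact (Nat.div_eq_of_eq_mul_left two_pos (by ring)).symm
  · rintro ⟨t₁, t₂⟩
    refine ⟨fun hz => ?_, fun hz => ?_, ?_⟩
    · rw [← (hzero hz).2.2.1 t₁ t₂, hGφ]
    · rw [← (hneg hz).2.2.1 t₁ t₂, hGφ]
    · rw [hL, hDdeg, h₃ t₁ t₂, hX₂.natDegree_mul hprod, hdX₂, hdeg, ha₁, hs₂, hm₂]
      congr 1
      exact (Nat.div_eq_of_eq_mul_left two_pos (by ring)).symm
  · rintro ⟨t₁, t₂⟩
    refine ⟨fun hz => ?_, fun hz => ?_, ?_⟩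
    · rw [← (hzero hz).2.2.2.1 t₁ t₂, hGφ]
    · rw [← (hneg hz).2.2.2.1 t₁ t₂, hGφ]
    · rw [hL, hDdeg, h₄ t₁ t₂, hX₁.natDegree_mul hprod, hdX₁, hdeg, hs₁, ha₂, hm₁]
      congr 1
      exact (Nat.div_eq_of_eq_mul_left two_pos (by ring)).symm
  · rintro ⟨t₁, t₂⟩
    refine ⟨fun hz => ?_, fun hz => ?_, ?_⟩
    · rw [← (hzero hz).2.2.2.2 t₁ t₂, ← mul_assoc, hGφ]
    · rw [← (hneg hz).2.2.2.2 t₁ t₂, ← mul_assoc, hGφ]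
    · have hadd := congrArg natDegree (h₅ t₁ t₂)
      rw [(hmonic.map φ).natDegree_mul hX, (hX₁.mul hX₂).natDegree_mul hprod,
        hX₁.natDegree_mul hX₂, hdX, hdX₁, hdX₂, hdeg] at hadd
      have hquot : ((n₁ + 1) * (n₂ + 1) - 2) / 2 = 2 * (m₁ + 1) * (m₂ + 1) - 1 := by
        rw [ha₁, ha₂, show 2 * (m₁ + 1) * (2 * (m₂ + 1)) = 2 * (2 * (m₁ + 1) * (m₂ + 1)) by ring]
        omega
      have hring : 2 * (m₁ + 1) * (m₂ + 1) = 2 * (m₁ * m₂) + 2 * m₁ + 2 * m₂ + 2 := by ring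
      rw [hL, hDdeg, hquot]
      omega
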